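/- For every integer n ≥ 0, Q(n) + 2 Σ_{j=1}^{∞} (−1)^j Q(n − 2j²) equals (−1)^{T_{⌊m/2⌋}} if n = G_m for some (necessarily unique) integer m ≥ 0, and equals 0 otherwise; the sum is finite since Q vanishes on negative arguments. -/

import Mathlib

/-- The `n`-th triangular number `T n = n(n+1)/2`. -/
def T (n : ℕ) : ℕ := n * (n + 1) / 2

/-- The `n`-th generalized pentagonal number `G n = T n - T ⌊n/2⌋`. -/
def G (n : ℕ) : ℕ := T n - T (n / 2)

/-- The number of partitions of `n` into distinct parts, vanishing on negative integers. -/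
def Q (n : ℤ) : ℤ :=
  if 0 ≤ n then ((Nat.Partition.distincts n.toNat).card : ℤ) else 0

open Classical in
/-- `ε(n) = (-1)^(T ⌊m/2⌋)` if `n = G m` for the (unique) `m`, and `0` otherwise. -/
noncomputable def eps (n : ℕ) : ℤ := if h : ∃ m, n = G m then (-1) ^ (T (h.choose / 2)) else 0

open Finset PowerSeries Filter
open scoped PowerSeries.WithPiTopology

section FiniteGauss

variable {R : Type*} [CommRing R] {q : R} {t : ℕ → R}

theorem prod_one_sub_pow_mul_eq_prod_one_add_pow (h0 : t 0 = 1)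
    (ht : ∀ s, t (s + 1) * (1 - q ^ (s + 1)) = -(t s * (1 + q ^ s))) (n : ℕ) :
    (∏ i ∈ range n, (1 - q ^ (i + 1))) * (t n * (1 + q ^ n)) =
      2 * (-1) ^ n * ∏ i ∈ range n, (1 + q ^ (i + 1)) := by
  induction n with
  | zero => simp [h0]; norm_num
  | succ n ih =>
    rw [prod_range_succ, prod_range_succ]
    linear_combination (∏ i ∈ range n, (1 - q ^ (i + 1))) * (1 + q ^ (n + 1)) * ht n -
      (1 + q ^ (n + 1)) * ih

theorem sum_telescope_of_recurrence
    (ht : ∀ s, t (s + 1) * (1 - q ^ (s + 1)) = -(t s * (1 + q ^ s))) (m k : ℕ) :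
    (1 - q ^ m) * ∑ s ∈ range k, t s * q ^ (s * (m + 1)) -
      (1 + q ^ m) * ∑ s ∈ range k, t s * q ^ (s * m) = t k * (1 - q ^ k) * q ^ (k * m) := by
  induction k with
  | zero => simp
  | succ k ih =>
    rw [sum_range_succ, sum_range_succ]
    linear_combination ih - q ^ ((k + 1) * m) * ht k

/-- A finite form of Gauss's identity for the alternating sum of `q ^ j ^ 2`. -/
theorem prod_one_add_pow_mul_alternating_sum_squares (h0 : t 0 = 1)
    (ht : ∀ s, t (s + 1) * (1 - q ^ (s + 1)) = -(t s * (1 + q ^ s))) (n : ℕ) :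
    (∏ i ∈ range n, (1 + q ^ (i + 1))) *
        (1 + 2 * ∑ j ∈ range n, (-1) ^ (j + 1) * q ^ (j + 1) ^ 2) =
      (∏ i ∈ range n, (1 - q ^ (i + 1))) * ∑ s ∈ range (n + 1), t s * q ^ (s * (n + 1)) := by
  induction n with
  | zero => simp [h0]
  | succ n ih =>
    have htel := sum_telescope_of_recurrence ht (n + 1) (n + 1)
    have hprod := prod_one_sub_pow_mul_eq_prod_one_add_pow h0 ht n
    rw [prod_range_succ, prod_range_succ, sum_range_succ, sum_range_succ _ (n + 1)]
    generalize (∏ i ∈ range n, (1 - q ^ (i + 1))) = P at *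
    generalize (∏ i ∈ range n, (1 + q ^ (i + 1))) = M at *
    generalize (∑ s ∈ range (n + 1), t s * q ^ (s * (n + 1 + 1))) = A' at *
    generalize (∑ s ∈ range (n + 1), t s * q ^ (s * (n + 1))) = A at *
    linear_combination (1 + q ^ (n + 1)) * ih - P * htel
      + (1 + q ^ (n + 1)) * q ^ (n + 1) ^ 2 * hprod
      - (1 + q ^ (n + 1)) * q ^ (n + 1) ^ 2 * P * ht n

theorem prod_even_mul_prod_odd (f : ℕ → R) (n : ℕ) :
    (∏ i ∈ range n, f (2 * (i + 1))) * ∏ i ∈ range n, f (2 * i + 1) =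
      ∏ i ∈ range (2 * n), f (i + 1) := by
  induction n with
  | zero => simp
  | succ n ih =>
    rw [show 2 * (n + 1) = 2 * n + 1 + 1 by ring, prod_range_succ, prod_range_succ,
      prod_range_succ, prod_range_succ, ← ih, show 2 * (n + 1) = 2 * n + 1 + 1 by ring]
    ring

end FiniteGauss

theorem exists_recurrence (d : ℕ) (hd : d ≠ 0) : ∃ t : ℕ → ℤ⟦X⟧, t 0 = 1 ∧
    ∀ s, t (s + 1) * (1 - (X ^ d) ^ (s + 1)) = -(t s * (1 + (X ^ d) ^ s)) := by
  have hu (s : ℕ) : ∃ v : ℤ⟦X⟧, v * (1 - (X ^ d) ^ (s + 1)) = 1 := by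
    have : IsUnit (1 - (X ^ d) ^ (s + 1) : ℤ⟦X⟧) := by
      rw [PowerSeries.isUnit_iff_constantCoeff]
      simp [hd]
    exact this.exists_left_inv
  choose v hv using hu
  refine ⟨fun n ↦ Nat.rec 1 (fun s r ↦ -(r * (1 + (X ^ d) ^ s)) * v s) n, rfl, fun s ↦ ?_⟩
  simp only
  rw [mul_assoc, hv, mul_one]

theorem X_pow_dvd_prod_mul_sub (N : ℕ) :
    (X : ℤ⟦X⟧) ^ (2 * (N + 1)) ∣
      (∏ i ∈ range (2 * N), (1 + X ^ (i + 1))) *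
        (1 + 2 * ∑ j ∈ range N, (-1) ^ (j + 1) * X ^ (2 * (j + 1) ^ 2)) -
      evalNegHom (∏ i ∈ range (2 * N), (1 - X ^ (i + 1))) := by
  obtain ⟨t, h0, ht⟩ := exists_recurrence 2 two_ne_zero
  have key := prod_one_add_pow_mul_alternating_sum_squares h0 ht N
  rw [sum_range_succ'] at key
  simp only [← pow_mul, h0, zero_mul, pow_zero, mul_one] at key
  have hplus := prod_even_mul_prod_odd (fun k ↦ (1 + X ^ k : ℤ⟦X⟧)) N
  have hneg := prod_even_mul_prod_odd (fun k ↦ (1 - (-X) ^ k : ℤ⟦X⟧)) N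
  simp only [pow_mul, pow_succ _ (2 * _), neg_sq] at hneg
  simp only [map_prod, map_sub, map_one, map_pow, evalNegHom_X]
  rw [← hplus, ← hneg]
  have hdvd : (X : ℤ⟦X⟧) ^ (2 * (N + 1)) ∣
      ∑ s ∈ range N, t (s + 1) * X ^ (2 * ((s + 1) * (N + 1))) :=
    dvd_sum fun s _ ↦ (pow_dvd_pow _ (by nlinarith)).mul_left _
  obtain ⟨c, hc⟩ := hdvd
  rw [hc] at key
  refine ⟨(∏ i ∈ range N, (1 - X ^ (2 * (i + 1)))) * (∏ i ∈ range N, (1 + X ^ (2 * i + 1))) * c, ?_⟩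
  have hodd : ∏ i ∈ range N, (1 - (X ^ 2) ^ i * -X : ℤ⟦X⟧) =
      ∏ i ∈ range N, (1 + X ^ (2 * i + 1)) := prod_congr rfl fun i _ ↦ by ring
  rw [hodd]
  simp only [← pow_mul]
  linear_combination (∏ i ∈ range N, (1 + X ^ (2 * i + 1) : ℤ⟦X⟧)) * key

theorem eventually_coeff_prod_one_add_X_pow (k : ℕ) :
    ∀ᶠ N in atTop, (∏ i ∈ range N, (1 + X ^ (i + 1) : ℤ⟦X⟧)).coeff k = Q k := by
  have h := Nat.Partition.hasProd_powerSeriesMk_card_countRestricted ℤ two_pos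
  rw [HasProd, WithPiTopology.tendsto_iff_coeff_tendsto] at h
  have h' := (h k).comp tendsto_finset_range
  rw [nhds_discrete, tendsto_pure] at h'
  filter_upwards [h'] with N hN
  have hprod : ∏ i ∈ range N, (1 + X ^ (i + 1) : ℤ⟦X⟧) =
      ∏ i ∈ range N, ∑ j ∈ range 2, X ^ ((i + 1) * j) :=
    prod_congr rfl fun i _ ↦ by rw [sum_range_succ, sum_range_one]; simp
  rw [hprod]
  simpa [Q, Nat.Partition.countRestricted_two] using hN

theorem eventually_coeff_prod_one_sub_X_pow (k : ℕ) :
    ∀ᶠ N in atTop, (∏ i ∈ range N, (1 - X ^ (i + 1) : ℤ⟦X⟧)).coeff k =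
      (pentagonalSeries ℤ).coeff k :=
  tendsto_finset_range.eventually (coeff_prod_one_sub_X_pow_eventually_eq ℤ k)

theorem coeff_identity (n : ℕ) :
    Q (n : ℤ) + 2 * ∑' j : ℕ, (-1 : ℤ) ^ (j + 1) * Q ((n : ℤ) - 2 * ((j : ℤ) + 1) ^ 2) =
      (-1) ^ n * (pentagonalSeries ℤ).coeff n := by
  have h2 : Tendsto (fun N : ℕ ↦ 2 * N) atTop atTop :=
    tendsto_id.const_mul_atTop' two_pos
  have hQ : ∀ᶠ N in atTop, ∀ k ∈ range (n + 1),
      (∏ i ∈ range (2 * N), (1 + X ^ (i + 1) : ℤ⟦X⟧)).coeff k = Q k :=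
    (eventually_all_finset _).2 fun k _ ↦ h2.eventually (eventually_coeff_prod_one_add_X_pow k)
  obtain ⟨N, hQ, hP, hN⟩ := (hQ.and ((h2.eventually (eventually_coeff_prod_one_sub_X_pow n)).and
    (eventually_ge_atTop n))).exists
  have hdvd := X_pow_dvd_iff.1 (X_pow_dvd_prod_mul_sub N) n (by omega)
  rw [map_sub, sub_eq_zero] at hdvd
  have htsum : ∑' j : ℕ, (-1 : ℤ) ^ (j + 1) * Q ((n : ℤ) - 2 * ((j : ℤ) + 1) ^ 2) =
      ∑ j ∈ range N, (-1 : ℤ) ^ (j + 1) * Q ((n : ℤ) - 2 * ((j : ℤ) + 1) ^ 2) := by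
    refine tsum_eq_sum fun j hj ↦ ?_
    have : N ≤ j := by simpa using hj
    rw [Q, if_neg (by push Not; nlinarith), mul_zero]
  rw [htsum, ← hP]
  have hneg : coeff n (evalNegHom (∏ i ∈ range (2 * N), (1 - X ^ (i + 1) : ℤ⟦X⟧))) =
      (-1) ^ n * coeff n (∏ i ∈ range (2 * N), (1 - X ^ (i + 1) : ℤ⟦X⟧)) := by
    rw [evalNegHom, coeff_rescale]
  rw [← hneg, ← hdvd, mul_add, mul_one, map_add, hQ n (by simp), mul_left_comm, two_mul, two_mul,
    map_add, mul_sum, map_sum]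
  have hterm (j : ℕ) : coeff n ((∏ i ∈ range (2 * N), (1 + X ^ (i + 1) : ℤ⟦X⟧)) *
      ((-1) ^ (j + 1) * X ^ (2 * (j + 1) ^ 2))) =
      (-1 : ℤ) ^ (j + 1) * Q ((n : ℤ) - 2 * ((j : ℤ) + 1) ^ 2) := by
    rw [mul_left_comm, show ((-1 : ℤ⟦X⟧) ^ (j + 1)) = C ((-1) ^ (j + 1)) by simp, coeff_C_mul,
      coeff_mul_X_pow']
    congr 1
    split_ifs with hj
    · rw [hQ _ (by simp), Nat.cast_sub hj]
      push_cast
      rfl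
    · rw [Q, if_neg]
      push Not at hj ⊢
      zify at hj
      linarith
  simp only [hterm]

theorem T_two_mul (a : ℕ) : T (2 * a) = a * (2 * a + 1) := by
  rw [T, mul_assoc, Nat.mul_div_cancel_left _ two_pos]

theorem T_two_mul_add_one (a : ℕ) : T (2 * a + 1) = (2 * a + 1) * (a + 1) := by
  rw [T, show (2 * a + 1) * (2 * a + 1 + 1) = 2 * ((2 * a + 1) * (a + 1)) by ring,
    Nat.mul_div_cancel_left _ two_pos]

theorem two_mul_T (a : ℕ) : 2 * T a = a * (a + 1) :=
  Nat.two_mul_div_two_of_even (Nat.even_mul_succ_self a)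

theorem G_two_mul_add_T (a : ℕ) : G (2 * a) + T a = a * (2 * a + 1) := by
  have h := two_mul_T a
  rw [G, Nat.mul_div_cancel_left _ two_pos, T_two_mul]
  exact Nat.sub_add_cancel (by nlinarith)

theorem G_two_mul_add_one_add_T (a : ℕ) : G (2 * a + 1) + T a = (2 * a + 1) * (a + 1) := by
  have h := two_mul_T a
  rw [G, show (2 * a + 1) / 2 = a by omega, T_two_mul_add_one]
  exact Nat.sub_add_cancel (by nlinarith)

theorem G_two_mul (a : ℕ) : G (2 * a) = pentagonal (-a) := by
  have h := two_mul_T a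
  have h1 := G_two_mul_add_T a
  have h2 := two_mul_natCast_pentagonal_neg a
  zify at *
  linarith

theorem G_two_mul_add_one (a : ℕ) : G (2 * a + 1) = pentagonal (a + 1) := by
  have h := two_mul_T a
  have h1 := G_two_mul_add_one_add_T a
  have h2 := two_mul_natCast_pentagonal (a + 1)
  zify at *
  linarith

theorem neg_one_pow_eq_mul_of_even_add {a b c : ℕ} (h : Even (a + b + c)) :
    (-1 : ℤ) ^ a = (-1) ^ b * (-1) ^ c := by
  rw [← pow_add]
  apply neg_one_pow_congr
  grind

theorem neg_one_pow_T_half (m : ℕ) :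
    (-1 : ℤ) ^ T (m / 2) = (-1) ^ G m * (pentagonalSeries ℤ).coeff (G m) := by
  obtain ⟨a, rfl | rfl⟩ := m.even_or_odd'
  · have h := G_two_mul_add_T a
    nth_rw 2 [G_two_mul]
    rw [coeff_pentagonalSeries_pentagonal, Nat.mul_div_cancel_left _ two_pos, Int.negOnePow_neg]
    have : ((Int.negOnePow (a : ℤ) : ℤˣ) : ℤ) = (-1) ^ a := by simp [Int.negOnePow]
    rw [Int.cast_id, this]
    refine neg_one_pow_eq_mul_of_even_add ⟨a * a + a, ?_⟩
    linarith
  · have h := G_two_mul_add_one_add_T a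
    nth_rw 2 [G_two_mul_add_one]
    rw [coeff_pentagonalSeries_pentagonal, show (2 * a + 1) / 2 = a by omega]
    have : ((Int.negOnePow ((a : ℤ) + 1) : ℤˣ) : ℤ) = (-1) ^ (a + 1) := by
      rw [← Nat.cast_succ, Int.negOnePow, zpow_natCast]
      simp
    rw [Int.cast_id, this]
    refine neg_one_pow_eq_mul_of_even_add ⟨(a + 1) * (a + 1), ?_⟩
    linarith

theorem exists_G_eq_pentagonal (k : ℤ) : ∃ m, pentagonal k = G m := by
  rcases le_or_gt k 0 with hk | hk
  · obtain ⟨a, rfl⟩ : ∃ a : ℕ, k = -a := ⟨k.natAbs, by omega⟩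
    exact ⟨2 * a, (G_two_mul a).symm⟩
  · obtain ⟨a, rfl⟩ : ∃ a : ℕ, k = a + 1 := ⟨(k - 1).toNat, by omega⟩
    exact ⟨2 * a + 1, (G_two_mul_add_one a).symm⟩

theorem eps_eq_coeff_pentagonalSeries (n : ℕ) :
    eps n = (-1) ^ n * (pentagonalSeries ℤ).coeff n := by
  rw [eps]
  split_ifs with h
  · rw [neg_one_pow_T_half, ← h.choose_spec]
  · rw [coeff_pentagonalSeries_eq_zero, mul_zero]
    rintro ⟨k, rfl⟩
    exact h (exists_G_eq_pentagonal k)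

theorem stmt_7 (n : ℕ) :
    Q (n : ℤ) + 2 * ∑' j : ℕ, (-1 : ℤ) ^ (j + 1) * Q ((n : ℤ) - 2 * ((j : ℤ) + 1) ^ 2) = eps n := by
  rw [coeff_identity, eps_eq_coeff_pentagonalSeries]
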